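/- For every finite connected simple graph G, cart(G) = sn(G) if and only if dsn(G) = sn(G). -/

import Mathlib

open SimpleGraph

universe u


/-- An egg of a graph `G`: a nonempty set of vertices inducing a connected subgraph. -/
def SimpleGraph.IsEgg {V : Type u} (G : SimpleGraph V) (A : Finset V) : Prop :=
  A.Nonempty ∧ (G.induce (A : Set V)).Connected

/-- A scramble on `G`: a nonempty finite collection of eggs. -/
def SimpleGraph.IsScramble {V : Type u} (G : SimpleGraph V) (S : Finset (Finset V)) : Prop :=
  S.Nonempty ∧ ∀ A ∈ S, G.IsEgg A

/-- The hitting number `h(S)`: the minimum cardinality of a set of vertices meeting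
every egg of `S`. -/
noncomputable def hittingNumber {V : Type u} (S : Finset (Finset V)) : ℕ :=
  sInf {n | ∃ H : Finset V, H.card = n ∧ ∀ A ∈ S, ∃ x ∈ H, x ∈ A}

/-- The number of edges of `G` with one endpoint in `A` and the other outside of `A`. -/
noncomputable def cutSize {V : Type u} (G : SimpleGraph V) (A : Set V) : ℕ :=
  Set.ncard {e : Sym2 V | ∃ u v, e = s(u, v) ∧ G.Adj u v ∧ u ∈ A ∧ v ∉ A}

/-- An egg-cut for a scramble `S`: a vertex subset `A` containing some egg of `S` and
whose complement contains some egg of `S`. -/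
def IsEggCut {V : Type u} (S : Finset (Finset V)) (A : Set V) : Prop :=
  (∃ B ∈ S, (B : Set V) ⊆ A) ∧ (∃ B ∈ S, (B : Set V) ⊆ Aᶜ)

/-- The egg-cut number `e(S)` (in `ℕ∞`): the minimum size of an egg-cut for `S`,
or `⊤` if no egg-cut exists. -/
noncomputable def eggCutNumber {V : Type u} (G : SimpleGraph V) (S : Finset (Finset V)) : ℕ∞ :=
  sInf {n : ℕ∞ | ∃ A : Set V, IsEggCut S A ∧ n = (cutSize G A : ℕ∞)}

/-- The order `‖S‖` of a scramble: the minimum of its hitting number and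
its egg-cut number. -/
noncomputable def scrambleOrder {V : Type u} (G : SimpleGraph V) (S : Finset (Finset V)) : ℕ∞ :=
  min (hittingNumber S : ℕ∞) (eggCutNumber G S)

/-- The scramble number `sn(G)`: the maximum order of a scramble on `G`. -/
noncomputable def scrambleNumber {V : Type u} (G : SimpleGraph V) : ℕ :=
  sSup {n | ∃ S : Finset (Finset V), G.IsScramble S ∧ scrambleOrder G S = (n : ℕ∞)}

/-- A disjoint scramble: a scramble whose eggs are pairwise disjoint. -/
def IsDisjointScramble {V : Type u} (G : SimpleGraph V) (S : Finset (Finset V)) : Prop :=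
  G.IsScramble S ∧ (S : Set (Finset V)).Pairwise fun A B => Disjoint (A : Set V) (B : Set V)

/-- The disjoint scramble number `dsn(G)`: the maximum order of a disjoint scramble on `G`. -/
noncomputable def disjointScrambleNumber {V : Type u} (G : SimpleGraph V) : ℕ :=
  sSup {n | ∃ S : Finset (Finset V), IsDisjointScramble G S ∧ scrambleOrder G S = (n : ℕ∞)}

/-- The carton number `cart(G)`: the minimum size (number of eggs) of a scramble on `G`
whose order equals the scramble number of `G`. -/
noncomputable def cartonNumber {V : Type u} (G : SimpleGraph V) : ℕ :=
  sInf {n | ∃ S : Finset (Finset V), G.IsScramble S ∧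
    scrambleOrder G S = (scrambleNumber G : ℕ∞) ∧ S.card = n}

/-- The maximum degree of a graph. -/
noncomputable def maxDeg {V : Type u} (G : SimpleGraph V) : ℕ :=
  sSup {n | ∃ v : V, (G.neighborSet v).ncard = n}

section Scramble

variable {V : Type u} {G : SimpleGraph V} {S T : Finset (Finset V)}

theorem hittingNumber_le_card_of_hits {H : Finset V} (hH : ∀ A ∈ S, ∃ x ∈ H, x ∈ A) :
    hittingNumber S ≤ H.card :=
  Nat.sInf_le ⟨H, rfl, hH⟩

theorem exists_hits_card_le (hS : ∀ A ∈ S, A.Nonempty) :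
    ∃ H : Finset V, H.card ≤ S.card ∧ ∀ A ∈ S, ∃ x ∈ H, x ∈ A := by
  classical
  choose f hf using hS
  refine ⟨S.attach.image fun A => f A.1 A.2, ?_, fun A hA => ⟨f A hA, ?_, hf A hA⟩⟩
  · exact Finset.card_image_le.trans_eq S.card_attach
  · exact Finset.mem_image.2 ⟨⟨A, hA⟩, Finset.mem_attach _ _, rfl⟩

theorem exists_hits_card_eq_hittingNumber (hS : ∀ A ∈ S, A.Nonempty) :
    ∃ H : Finset V, H.card = hittingNumber S ∧ ∀ A ∈ S, ∃ x ∈ H, x ∈ A := by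
  obtain ⟨H, -, hH⟩ := exists_hits_card_le hS
  exact Nat.sInf_mem (s := {n | ∃ H : Finset V, H.card = n ∧ ∀ A ∈ S, ∃ x ∈ H, x ∈ A})
    ⟨_, H, rfl, hH⟩

theorem hittingNumber_le_card (hS : ∀ A ∈ S, A.Nonempty) : hittingNumber S ≤ S.card := by
  obtain ⟨H, hc, hH⟩ := exists_hits_card_le hS
  exact (hittingNumber_le_card_of_hits hH).trans hc

/-- Two eggs with a common vertex can be hit at once. -/
theorem pairwise_disjoint_of_card_le_hittingNumber (hS : ∀ A ∈ S, A.Nonempty)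
    (h : S.card ≤ hittingNumber S) :
    (S : Set (Finset V)).Pairwise fun A B => Disjoint (A : Set V) (B : Set V) := by
  classical
  intro A hA B hB hAB
  rw [Set.disjoint_left]
  intro x hxA hxB
  obtain ⟨H, hc, hH⟩ := exists_hits_card_le (S := (S.erase A).erase B)
    fun C hC => hS C (Finset.mem_of_mem_erase (Finset.mem_of_mem_erase hC))
  have hB' : B ∈ S.erase A := Finset.mem_erase.2 ⟨hAB.symm, hB⟩
  have h1 := Finset.card_erase_add_one hB'
  have h2 := Finset.card_erase_add_one (Finset.mem_coe.1 hA)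
  have h3 : hittingNumber S ≤ (insert x H).card := by
    refine hittingNumber_le_card_of_hits fun C hC => ?_
    by_cases hCA : C = A
    · exact ⟨x, Finset.mem_insert_self _ _, hCA ▸ hxA⟩
    by_cases hCB : C = B
    · exact ⟨x, Finset.mem_insert_self _ _, hCB ▸ hxB⟩
    obtain ⟨y, hy, hyC⟩ := hH C (by simp [hCA, hCB, hC])
    exact ⟨y, Finset.mem_insert_of_mem hy, hyC⟩
  have h4 := Finset.card_insert_le x H
  omega

theorem card_le_hittingNumber_of_pairwise_disjoint (hS : ∀ A ∈ S, A.Nonempty)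
    (hd : (S : Set (Finset V)).Pairwise fun A B => Disjoint (A : Set V) (B : Set V)) :
    S.card ≤ hittingNumber S := by
  classical
  obtain ⟨H, hc, hH⟩ := exists_hits_card_eq_hittingNumber hS
  rw [← hc]
  choose f hfH hf using hH
  rw [← S.card_attach]
  refine Finset.card_le_card_of_injOn (fun A => f A.1 A.2) (fun A _ => hfH A.1 A.2) ?_
  intro A _ B _ hAB
  by_contra hne
  refine Set.disjoint_left.1 (hd A.2 B.2 fun h => hne (Subtype.ext h)) (hf A.1 A.2) ?_
  have := hf B.1 B.2
  rwa [← show f A.1 A.2 = f B.1 B.2 from hAB] at this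

theorem eggCutNumber_le_of_subset (h : T ⊆ S) : eggCutNumber G S ≤ eggCutNumber G T := by
  refine sInf_le_sInf ?_
  rintro n ⟨A, ⟨⟨B, hB, hBA⟩, C, hC, hCA⟩, rfl⟩
  exact ⟨A, ⟨⟨B, h hB, hBA⟩, C, h hC, hCA⟩, rfl⟩

theorem SimpleGraph.IsScramble.nonempty_of_mem (hS : G.IsScramble S) : ∀ A ∈ S, A.Nonempty :=
  fun A hA => (hS.2 A hA).1

theorem SimpleGraph.IsScramble.le_card_of_scrambleOrder_eq (hS : G.IsScramble S) {n : ℕ}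
    (h : scrambleOrder G S = n) : n ≤ S.card := by
  have h1 : (n : ℕ∞) ≤ hittingNumber S := h ▸ min_le_left _ _
  exact (Nat.cast_le.1 h1).trans (hittingNumber_le_card hS.nonempty_of_mem)

theorem isDisjointScramble_singleton (v : V) : IsDisjointScramble G {{v}} := by
  refine ⟨⟨Finset.singleton_nonempty _, fun A hA => ?_⟩, by simp⟩
  obtain rfl := Finset.mem_singleton.1 hA
  refine ⟨Finset.singleton_nonempty _, ?_⟩
  rw [Finset.coe_singleton]
  exact ⟨.of_subsingleton⟩

theorem scrambleOrder_singleton (v : V) : scrambleOrder G {{v}} = ((1 : ℕ) : ℕ∞) := by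
  have hne : ∀ A ∈ ({{v}} : Finset (Finset V)), A.Nonempty :=
    (isDisjointScramble_singleton (G := ⊥) v).1.nonempty_of_mem
  have h1 : hittingNumber {({v} : Finset V)} = 1 :=
    le_antisymm (hittingNumber_le_card hne)
      (card_le_hittingNumber_of_pairwise_disjoint hne (by simp))
  have h2 : eggCutNumber G {{v}} = ⊤ := by
    rw [eggCutNumber, sInf_eq_top]
    rintro n ⟨A, ⟨⟨B, hB, hBA⟩, C, hC, hCA⟩, -⟩
    obtain rfl := Finset.mem_singleton.1 hB
    obtain rfl := Finset.mem_singleton.1 hC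
    exact absurd (hBA (Finset.mem_singleton_self v)) (hCA (Finset.mem_singleton_self v))
  rw [scrambleOrder, h1, h2, min_eq_left le_top]

variable [Fintype V]

theorem bddAbove_scrambleOrder (G : SimpleGraph V) :
    BddAbove {n : ℕ | ∃ S : Finset (Finset V), G.IsScramble S ∧ scrambleOrder G S = (n : ℕ∞)} := by
  refine ⟨Fintype.card V, ?_⟩
  rintro n ⟨S, hS, h⟩
  have h1 : (n : ℕ∞) ≤ hittingNumber S := h ▸ min_le_left _ _
  refine (Nat.cast_le.1 h1).trans (hittingNumber_le_card_of_hits fun A hA => ?_)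
  obtain ⟨x, hx⟩ := hS.nonempty_of_mem A hA
  exact ⟨x, Finset.mem_univ x, hx⟩

theorem le_scrambleNumber (hS : G.IsScramble S) {n : ℕ} (h : scrambleOrder G S = n) :
    n ≤ scrambleNumber G :=
  le_csSup (bddAbove_scrambleOrder G) ⟨S, hS, h⟩

theorem bddAbove_disjoint_scrambleOrder (G : SimpleGraph V) :
    BddAbove {n : ℕ | ∃ S : Finset (Finset V),
      IsDisjointScramble G S ∧ scrambleOrder G S = (n : ℕ∞)} := by
  refine (bddAbove_scrambleOrder G).mono ?_
  rintro n ⟨S, hS, h⟩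
  exact ⟨S, hS.1, h⟩

theorem le_disjointScrambleNumber (hS : IsDisjointScramble G S) {n : ℕ}
    (h : scrambleOrder G S = n) : n ≤ disjointScrambleNumber G :=
  le_csSup (bddAbove_disjoint_scrambleOrder G) ⟨S, hS, h⟩

variable [Nonempty V]

theorem one_le_scrambleNumber (G : SimpleGraph V) : 1 ≤ scrambleNumber G :=
  le_scrambleNumber (isDisjointScramble_singleton (Classical.arbitrary V)).1
    (scrambleOrder_singleton _)

theorem exists_scrambleOrder_eq_scrambleNumber (G : SimpleGraph V) :
    ∃ S : Finset (Finset V), G.IsScramble S ∧ scrambleOrder G S = (scrambleNumber G : ℕ∞) :=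
  Nat.sSup_mem (s := {n : ℕ | ∃ S : Finset (Finset V), G.IsScramble S ∧
    scrambleOrder G S = (n : ℕ∞)})
    ⟨1, _, (isDisjointScramble_singleton (Classical.arbitrary V)).1, scrambleOrder_singleton _⟩
    (bddAbove_scrambleOrder G)

theorem exists_scrambleOrder_eq_disjointScrambleNumber (G : SimpleGraph V) :
    ∃ S : Finset (Finset V), IsDisjointScramble G S ∧
      scrambleOrder G S = (disjointScrambleNumber G : ℕ∞) :=
  Nat.sSup_mem (s := {n : ℕ | ∃ S : Finset (Finset V), IsDisjointScramble G S ∧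
    scrambleOrder G S = (n : ℕ∞)})
    ⟨1, _, isDisjointScramble_singleton (Classical.arbitrary V), scrambleOrder_singleton _⟩
    (bddAbove_disjoint_scrambleOrder G)

theorem disjointScrambleNumber_le_scrambleNumber (G : SimpleGraph V) :
    disjointScrambleNumber G ≤ scrambleNumber G := by
  obtain ⟨S, hS, h⟩ := exists_scrambleOrder_eq_disjointScrambleNumber G
  exact le_scrambleNumber hS.1 h

theorem exists_card_eq_cartonNumber (G : SimpleGraph V) :
    ∃ S : Finset (Finset V), G.IsScramble S ∧
      scrambleOrder G S = (scrambleNumber G : ℕ∞) ∧ S.card = cartonNumber G := by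
  obtain ⟨S, hS, h⟩ := exists_scrambleOrder_eq_scrambleNumber G
  exact Nat.sInf_mem (s := {n | ∃ S : Finset (Finset V), G.IsScramble S ∧
    scrambleOrder G S = (scrambleNumber G : ℕ∞) ∧ S.card = n}) ⟨_, S, hS, h, rfl⟩

theorem scrambleNumber_le_cartonNumber (G : SimpleGraph V) :
    scrambleNumber G ≤ cartonNumber G := by
  obtain ⟨S, hS, h, hc⟩ := exists_card_eq_cartonNumber G
  exact hc ▸ hS.le_card_of_scrambleOrder_eq h

end Scramble

/-- For every finite connected simple graph `G`,
`cart(G) = sn(G)` if and only if `dsn(G) = sn(G)`. -/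
theorem carton_eq_sn_iff_dsn_eq_sn {V : Type u} [Fintype V] (G : SimpleGraph V)
    (hconn : G.Connected) :
    cartonNumber G = scrambleNumber G ↔ disjointScrambleNumber G = scrambleNumber G := by
  have := hconn.nonempty
  constructor
  · intro hcart
    obtain ⟨S, hS, h, hc⟩ := exists_card_eq_cartonNumber G
    have h1 : (scrambleNumber G : ℕ∞) ≤ hittingNumber S := h ▸ min_le_left _ _
    have hd : IsDisjointScramble G S :=
      ⟨hS, pairwise_disjoint_of_card_le_hittingNumber hS.nonempty_of_mem
        ((hc.trans hcart).trans_le (Nat.cast_le.1 h1))⟩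
    exact (disjointScrambleNumber_le_scrambleNumber G).antisymm (le_disjointScrambleNumber hd h)
  · intro hdsn
    obtain ⟨S, hS, h⟩ := exists_scrambleOrder_eq_disjointScrambleNumber G
    rw [hdsn] at h
    obtain ⟨T, hTS, hT⟩ := Finset.exists_subset_card_eq (hS.1.le_card_of_scrambleOrder_eq h)
    have hscr : G.IsScramble T :=
      ⟨Finset.card_pos.1 (hT ▸ one_le_scrambleNumber G), fun A hA => hS.1.2 A (hTS hA)⟩
    have hhit : hittingNumber T = scrambleNumber G :=
      hT ▸ (hittingNumber_le_card hscr.nonempty_of_mem).antisymm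
        (card_le_hittingNumber_of_pairwise_disjoint hscr.nonempty_of_mem
          (hS.2.mono (Finset.coe_subset.2 hTS)))
    have hcut : (scrambleNumber G : ℕ∞) ≤ eggCutNumber G T :=
      (h ▸ min_le_right _ _ : (scrambleNumber G : ℕ∞) ≤ eggCutNumber G S).trans
        (eggCutNumber_le_of_subset hTS)
    have hord : scrambleOrder G T = (scrambleNumber G : ℕ∞) := by
      rw [scrambleOrder, hhit, min_eq_left hcut]
    exact le_antisymm (Nat.sInf_le ⟨T, hscr, hord, hT⟩) (scrambleNumber_le_cartonNumber G)
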